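/- Let d ≥ 2 and M, k ≥ 1 be integers, and let f be chosen uniformly at random from L_M(d,k). Then for every integer t ≥ 1 and α = 9/10 (for d = 2) or α = (3/4)^d (for d ≥ 3), Pr( f(v_0) = -(M + t) ) ≤ α^(d^⌊(t-1)/M⌋) · Pr( f(v_0) = 0 ). -/

import Mathlib

/-- The vertices of the rooted `d`-ary tree of depth `k`: sequences over `Fin d`
of length at most `k`.  The root is the empty sequence, the children of a vertex
`l` with `l.length < k` are the vertices `l ++ [j]` for `j : Fin d`, and the
leaves are the vertices of length exactly `k`. -/
abbrev Vtx (d k : ℕ) : Type := {l : List (Fin d) // l.length ≤ k}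

/-- The root `v₀` of the tree. -/
def rootV (d k : ℕ) : Vtx d k := ⟨[], by simp⟩

/-- `L_M(d,k)`: the set of integer-valued `M`-Lipschitz functions on the
`d`-ary tree of depth `k` that vanish on all leaves. -/
def LM (d k M : ℕ) : Set (Vtx d k → ℤ) :=
  {f | (∀ v : Vtx d k, v.1.length = k → f v = 0) ∧
       (∀ (l : List (Fin d)) (hl : l.length + 1 ≤ k) (j : Fin d),
         |f ⟨l ++ [j], by simpa using hl⟩ - f ⟨l, Nat.le_of_succ_le hl⟩| ≤ (M : ℤ))}

/-- `G(t,k)`: the number of functions in `L_M(d,k)` whose value at the root is `t`. -/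
noncomputable def G (d k M : ℕ) (t : ℤ) : ℕ :=
  Nat.card {f : Vtx d k → ℤ // f ∈ LM d k M ∧ f (rootV d k) = t}

/-- The probability that a uniformly random element of `L_M(d,k)` takes the
value `t` at the root. -/
noncomputable def PrRoot (d k M : ℕ) (t : ℤ) : ℝ :=
  (G d k M t : ℝ) / (Nat.card (LM d k M) : ℝ)

open Finset in
/-- The sum of `h` over the window of radius `M` around `t`. -/
def boxSum (M : ℕ) (h : ℤ → ℝ) (t : ℤ) : ℝ :=
  ∑ i ∈ range (2 * M + 1), h (t - M + i)

/-- Nonnegative, symmetric, unimodal and log-concave functions on `ℤ`. -/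
structure IsBump (h : ℤ → ℝ) : Prop where
  nonneg : ∀ x, 0 ≤ h x
  pos : 0 < h 0
  anti : ∀ x y, |x| ≤ |y| → h y ≤ h x
  lc : ∀ a b, a ≤ b → h a * h (b + 1) ≤ h (a + 1) * h b

namespace IsBump

variable {h : ℤ → ℝ} {M : ℕ}

lemma symm (H : IsBump h) (x : ℤ) : h (-x) = h x :=
  le_antisymm (H.anti _ _ (by simp)) (H.anti _ _ (by simp))

lemma anti_of_nonneg (H : IsBump h) {x y : ℤ} (hx : 0 ≤ x) (hxy : x ≤ y) : h y ≤ h x :=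
  H.anti _ _ (by rw [abs_of_nonneg hx, abs_of_nonneg (hx.trans hxy)]; exact hxy)

lemma pos_of_between (H : IsBump h) {a b x : ℤ} (hax : a ≤ x) (hxb : x ≤ b)
    (ha : 0 < h a) (hb : 0 < h b) : 0 < h x := by
  rcases le_total 0 x with hx | hx
  · exact hb.trans_le (H.anti_of_nonneg hx hxb)
  · refine ha.trans_le (H.anti _ _ ?_)
    rw [abs_of_nonpos hx, abs_of_nonpos (hax.trans hx)]
    linarith

lemma mul_shift_le (H : IsBump h) {a b : ℤ} (hab : a ≤ b) (c : ℕ) :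
    h a * h (b + c) ≤ h (a + c) * h b := by
  induction c with
  | zero => simp
  | succ c ih =>
    rcases (H.nonneg a).eq_or_lt with ha | ha
    · rw [← ha, zero_mul]; exact mul_nonneg (H.nonneg _) (H.nonneg _)
    rcases (H.nonneg (b + (c + 1 : ℕ))).eq_or_lt with hb | hb
    · rw [← hb, mul_zero]; exact mul_nonneg (H.nonneg _) (H.nonneg _)
    have h1 : 0 < h (a + c) := H.pos_of_between (by omega) (by push_cast; omega) ha hb
    have h2 : 0 < h (b + c) := H.pos_of_between (by omega) (by push_cast; omega) ha hb
    have h3 := H.lc (a + c) (b + c) (by omega)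
    push_cast at hb ⊢
    rw [← add_assoc, ← add_assoc]
    rw [← add_assoc] at hb
    have h4 := mul_le_mul ih h3 (mul_nonneg h1.le hb.le) (mul_nonneg h1.le (H.nonneg _))
    refine le_of_mul_le_mul_left ?_ (mul_pos h1 h2)
    linarith

lemma shift_le_mul (H : IsBump h) {a b : ℤ} (ha : 0 ≤ a) (hab : a ≤ b) {c : ℝ} (hc : 0 ≤ c)
    (hbc : h b ≤ c * h a) (i : ℕ) : h (b + i) ≤ c * h (a + i) := by
  rcases (H.nonneg a).eq_or_lt with h0 | h0
  · have := H.anti_of_nonneg (x := a) (y := b + i) ha (by omega)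
    have := mul_nonneg hc (H.nonneg (a + i))
    linarith
  · have h1 := H.mul_shift_le hab i
    have h2 := mul_le_mul_of_nonneg_left hbc (H.nonneg (a + i))
    refine le_of_mul_le_mul_left ?_ h0
    linarith

end IsBump

section BoxSum

open Finset

variable {h : ℤ → ℝ} {M : ℕ}

lemma boxSum_add_one (M : ℕ) (h : ℤ → ℝ) (t : ℤ) :
    boxSum M h (t + 1) = boxSum M h t + h (t + M + 1) - h (t - M) := by
  unfold boxSum
  have h1 := sum_range_succ (fun i : ℕ => h (t - M + i)) (2 * M + 1)
  have h2 := sum_range_succ' (fun i : ℕ => h (t - M + i)) (2 * M + 1)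
  have e1 : h (t + M + 1) = h (t - M + (2 * M + 1 : ℕ)) := by congr 1; push_cast; ring
  have e2 : ∀ i : ℕ, h (t + 1 - M + i) = h (t - M + (i + 1 : ℕ)) := by
    intro i; congr 1; push_cast; ring
  simp only [e1, e2]
  rw [h1] at h2
  simp only [Nat.cast_zero, add_zero] at h2
  linarith

lemma boxSum_shift (M : ℕ) (h : ℤ → ℝ) (t : ℤ) :
    boxSum M h (M + t) =
      ∑ i ∈ range M, h (t + i) + ∑ i ∈ range (M + 1), h (t + M + i) := by
  unfold boxSum
  rw [show 2 * M + 1 = M + (M + 1) by ring, sum_range_add]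
  congr 1 <;> refine sum_congr rfl fun i _ => ?_ <;> congr 1 <;> push_cast <;> ring

lemma sum_window_shift (M : ℕ) (h : ℤ → ℝ) :
    ∑ i ∈ range (M + 1), h i = h 0 + ∑ i ∈ range M, h (1 + i) := by
  rw [sum_range_succ', add_comm]
  simp [add_comm]

lemma boxSum_neg (H : IsBump h) (t : ℤ) : boxSum M h (-t) = boxSum M h t := by
  unfold boxSum
  rw [← sum_range_reflect]
  refine sum_congr rfl fun i hi => ?_
  rw [← H.symm]
  congr 1
  have := mem_range.1 hi
  omega

lemma boxSum_zero (H : IsBump h) :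
    boxSum M h 0 = h 0 + 2 * ∑ i ∈ range M, h (1 + i) := by
  have h1 : boxSum M h 0 = boxSum M h (M + (-M : ℤ)) := by simp
  rw [h1, boxSum_shift, ← sum_range_reflect]
  have h2 : ∀ i ∈ range M, h (-(M : ℤ) + ((M - 1 - i : ℕ) : ℤ)) = h (1 + i) := by
    intro i hi
    rw [← H.symm]
    congr 1
    have := mem_range.1 hi
    omega
  rw [sum_congr rfl h2]
  have h3 := sum_window_shift M h
  simp only [neg_add_cancel, zero_add]
  linarith

lemma boxSum_one (H : IsBump h) :
    boxSum M h 1 = ∑ i ∈ range M, h i + ∑ i ∈ range (M + 1), h (1 + i) := by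
  have h1 : boxSum M h 1 = boxSum M h (M + (1 - M : ℤ)) := by congr 1; ring
  rw [h1, boxSum_shift, ← sum_range_reflect]
  have h2 : ∀ i ∈ range M, h ((1 - M : ℤ) + ((M - 1 - i : ℕ) : ℤ)) = h i := by
    intro i hi
    rw [← H.symm]
    congr 1
    have := mem_range.1 hi
    omega
  rw [sum_congr rfl h2]
  simp

lemma boxSum_nonneg (H : IsBump h) (t : ℤ) : 0 ≤ boxSum M h t :=
  sum_nonneg fun _ _ => H.nonneg _

lemma boxSum_zero_pos (H : IsBump h) : 0 < boxSum M h 0 := by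
  rw [boxSum_zero H]
  have := sum_nonneg (s := range M) (f := fun i : ℕ => h (1 + i)) fun _ _ => H.nonneg _
  linarith [H.pos]

lemma boxSum_anti (H : IsBump h) (x y : ℤ) (hxy : |x| ≤ |y|) :
    boxSum M h y ≤ boxSum M h x := by
  have h1 : Antitone fun n : ℕ => boxSum M h n := antitone_nat_of_succ_le fun n => by
    push_cast
    rw [boxSum_add_one]
    have := H.anti ((n : ℤ) - M) (n + M + 1) (by rw [abs_le, abs_of_nonneg] <;> omega)
    linarith
  have h2 : ∀ z : ℤ, boxSum M h z = boxSum M h (z.natAbs : ℕ) := by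
    intro z
    rcases Int.natAbs_eq z with hz | hz
    · rw [← hz]
    · conv_lhs => rw [hz]
      exact boxSum_neg H _
  rw [h2 x, h2 y]
  exact h1 (by simpa only [Int.abs_eq_natAbs, Nat.cast_le] using hxy)

lemma boxSum_lc (H : IsBump h) (a b : ℤ) (hab : a ≤ b) :
    boxSum M h a * boxSum M h (b + 1) ≤ boxSum M h (a + 1) * boxSum M h b := by
  rw [boxSum_add_one, boxSum_add_one]
  have h1 : h (b + M + 1) * boxSum M h a ≤ h (a + M + 1) * boxSum M h b := by
    unfold boxSum
    rw [mul_sum, mul_sum]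
    refine sum_le_sum fun i hi => ?_
    have hi := mem_range.1 hi
    have := H.mul_shift_le (a := a - M + i) (b := b - M + i) (by omega) (2 * M + 1 - i)
    rw [show b - M + i + ((2 * M + 1 - i : ℕ) : ℤ) = b + M + 1 by omega,
      show a - M + i + ((2 * M + 1 - i : ℕ) : ℤ) = a + M + 1 by omega] at this
    linarith
  have h2 : h (a - M) * boxSum M h b ≤ h (b - M) * boxSum M h a := by
    unfold boxSum
    rw [mul_sum, mul_sum]
    refine sum_le_sum fun i _ => ?_
    have := H.mul_shift_le (a := a - M) (b := b - M) (by omega) i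
    linarith
  linarith

lemma isBump_boxSum_pow (H : IsBump h) (d : ℕ) : IsBump fun t => boxSum M h t ^ d where
  nonneg x := pow_nonneg (boxSum_nonneg H x) d
  pos := pow_pos (boxSum_zero_pos H) d
  anti x y hxy := pow_le_pow_left₀ (boxSum_nonneg H y) (boxSum_anti H x y hxy) d
  lc a b hab := by
    rw [← mul_pow, ← mul_pow]
    exact pow_le_pow_left₀ (mul_nonneg (boxSum_nonneg H _) (boxSum_nonneg H _))
      (boxSum_lc H a b hab) d

lemma boxSum_shift_le (H : IsBump h) {t : ℤ} (ht : 0 ≤ t) {c : ℝ} (hc : 0 ≤ c)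
    (htc : h t ≤ c * h 0) : boxSum M h (M + t) ≤ c * boxSum M h 0 := by
  have h1 : ∀ i : ℕ, h (t + i) ≤ c * h i := fun i => by
    simpa using H.shift_le_mul le_rfl ht hc htc i
  have h2 : ∑ i ∈ range (M + 1), h (t + i) ≤ c * ∑ i ∈ range (M + 1), h i := by
    rw [mul_sum]; exact sum_le_sum fun i _ => h1 i
  have h3 : ∑ i ∈ range M, h (t + M + (i + 1 : ℕ)) ≤ c * ∑ i ∈ range M, h (1 + i) := by
    rw [mul_sum]
    refine sum_le_sum fun i _ => (H.anti_of_nonneg (x := t + (i + 1 : ℕ)) (by omega)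
      (by omega)).trans ((h1 (i + 1)).trans_eq ?_)
    push_cast
    rw [add_comm (i : ℤ)]
  rw [sum_range_succ, sum_window_shift] at h2
  rw [boxSum_shift, sum_range_succ', boxSum_zero H]
  simp only [Nat.cast_zero, add_zero]
  linarith

lemma boxSum_succ_eq (M : ℕ) (h : ℤ → ℝ) :
    boxSum M h (M + 1) =
      ∑ i ∈ range M, h (1 + i) + ∑ i ∈ range (M + 1), h (M + 1 + i) := by
  rw [boxSum_shift, add_comm (1 : ℤ) M]

lemma boxSum_succ_le (H : IsBump h) {r : ℝ} (hr1 : r ≤ 1)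
    (hr : ∑ i ∈ range (M + 1), h (M + 1 + i) ≤ r * ∑ i ∈ range (M + 1), h i) :
    boxSum M h (M + 1) ≤ (1 + r) / 2 * boxSum M h 0 := by
  rw [sum_window_shift] at hr
  rw [boxSum_succ_eq, boxSum_zero H]
  nlinarith [H.pos]

lemma sum_window_le (H : IsBump h) {r : ℝ} (hr0 : 0 ≤ r) (hr : h (M + 1) ≤ r * h 0) :
    ∑ i ∈ range (M + 1), h (M + 1 + i) ≤ r * ∑ i ∈ range (M + 1), h i := by
  rw [mul_sum]
  exact sum_le_sum fun i _ => by
    simpa using H.shift_le_mul le_rfl (by omega : (0 : ℤ) ≤ M + 1) hr0 hr i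

lemma mul_sum_range_le_of_antitone {f : ℕ → ℝ} (hf : Antitone f) {i n : ℕ} (hin : i ≤ n) :
    (i : ℝ) * ∑ j ∈ range n, f j ≤ n * ∑ j ∈ range i, f j := by
  obtain ⟨m, rfl⟩ := Nat.exists_eq_add_of_le hin
  rw [sum_range_add]
  have h1 : ∑ j ∈ range m, f (i + j) ≤ m * f i := by
    simpa using sum_le_card_nsmul (range m) (fun j => f (i + j)) (f i)
      fun j _ => hf (Nat.le_add_right i j)
  have h2 : i * f i ≤ ∑ j ∈ range i, f j := by
    simpa using card_nsmul_le_sum (range i) f (f i) fun j hj => hf (mem_range.1 hj).le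
  push_cast
  nlinarith [mul_le_mul_of_nonneg_left h1 (Nat.cast_nonneg (α := ℝ) i),
    mul_le_mul_of_nonneg_left h2 (Nat.cast_nonneg (α := ℝ) m)]

lemma boxSum_two_mul_add_two_le (H : IsBump h) (hM : 1 ≤ M) (hr : h (M + 1) ≤ 9 / 10 * h 0)
    (hw : h (2 * M + 2) ≤ 69 / 100 * h 1) :
    boxSum M h (2 * M + 2) ≤ 83 / 100 * boxSum M h 1 := by
  have e : boxSum M h (2 * M + 2) = boxSum M h (M + (M + 2 : ℤ)) := by congr 1; ring
  rw [e, boxSum_shift, boxSum_one H]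
  have h1 : ∑ i ∈ range (M + 1), h (M + 2 + i) ≤
      9 / 10 * ∑ i ∈ range (M + 1), h (1 + i) := by
    rw [mul_sum]
    refine sum_le_sum fun i _ => ?_
    have := H.shift_le_mul le_rfl (by omega : (0 : ℤ) ≤ M + 1) (by norm_num) hr (1 + i)
    push_cast at this
    rw [zero_add] at this
    rwa [show (M : ℤ) + 2 + i = M + 1 + (1 + i) by ring]
  have h2 : ∑ i ∈ range M, h (M + 2 + M + (i + 1 : ℕ)) ≤ 69 / 100 * ∑ i ∈ range M, h i := by
    rw [mul_sum]
    refine sum_le_sum fun i _ => ?_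
    have h3 := H.shift_le_mul zero_le_one (by omega : (1 : ℤ) ≤ 2 * M + 2) (by norm_num) hw i
    have h4 := H.anti_of_nonneg (x := 2 * M + 2 + i) (y := M + 2 + M + (i + 1 : ℕ))
      (by omega) (by omega)
    have h5 := H.anti_of_nonneg (x := i) (y := 1 + i) (by omega) (by omega)
    linarith
  have h6 : ∑ i ∈ range M, h (1 + i) ≤ ∑ i ∈ range M, h i :=
    sum_le_sum fun i _ => H.anti_of_nonneg (by omega) (by omega)
  have h7 : h (1 + M) ≤ ∑ i ∈ range M, h i :=
    (H.anti_of_nonneg (x := (0 : ℕ)) (by simp) (by omega)).trans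
      (single_le_sum (f := fun i : ℕ => h i) (fun i _ => H.nonneg _) (mem_range.2 hM))
  have h8 := sum_range_succ (fun i : ℕ => h (1 + i)) M
  have h9 := sum_range_succ (fun i : ℕ => h (M + 2 + i)) M
  have h10 := sum_range_succ' (fun i : ℕ => h (M + 2 + M + i)) M
  simp only [Nat.cast_zero, add_zero] at h10
  linarith

lemma boxSum_drop (H : IsBump h) (hw : h (2 * M + 2) ≤ 69 / 100 * h 1) (i : ℕ) :
    boxSum M h (M + 1 + i) ≤ boxSum M h (M + 1) - 31 / 100 * ∑ j ∈ range i, h (1 + j) := by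
  induction i with
  | zero => simp
  | succ i ih =>
    push_cast
    rw [← add_assoc, boxSum_add_one, sum_range_succ]
    have h3 := H.shift_le_mul zero_le_one (by omega : (1 : ℤ) ≤ 2 * M + 2) (by norm_num) hw i
    rw [show (M : ℤ) + 1 + i + M + 1 = 2 * M + 2 + i by ring,
      show (M : ℤ) + 1 + i - M = 1 + i by ring]
    linarith

lemma antitone_one_add (H : IsBump h) : Antitone fun j : ℕ => h (1 + j) :=
  fun a b hab => H.anti_of_nonneg (by omega) (by omega)

lemma mul_boxSum_succ_le (H : IsBump h) :
    M * boxSum M h (M + 1) ≤ (2 * M + 1) * ∑ j ∈ range M, h (1 + j) := by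
  rw [boxSum_succ_eq, sum_range_succ]
  have h1 : ∑ i ∈ range M, h (M + 1 + i) ≤ ∑ j ∈ range M, h (1 + j) :=
    sum_le_sum fun i _ => H.anti_of_nonneg (by omega) (by omega)
  have h2 : M * h (M + 1 + M) ≤ ∑ j ∈ range M, h (1 + j) := by
    simpa using card_nsmul_le_sum (range M) (fun j : ℕ => h (1 + j)) (h (M + 1 + M))
      fun j hj => H.anti_of_nonneg (by omega) (by have := mem_range.1 hj; omega)
  nlinarith [mul_le_mul_of_nonneg_left h1 (Nat.cast_nonneg (α := ℝ) M)]

lemma boxSum_sq_drop (H : IsBump h) (hM : 1 ≤ M) (hw : h (2 * M + 2) ≤ 69 / 100 * h 1)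
    {i : ℕ} (hi : i ≤ M) :
    boxSum M h (M + 1 + i) ^ 2 ≤
      boxSum M h (M + 1) ^ 2 * (1 - 571 / 1000 * (i / (2 * M + 1))) := by
  have hM' : (0 : ℝ) < M := by exact_mod_cast hM
  have h1 := boxSum_drop H hw i
  have h2 := mul_sum_range_le_of_antitone (antitone_one_add H) hi
  have h3 := mul_boxSum_succ_le (M := M) H
  have hN : (0 : ℝ) < 2 * M + 1 := by positivity
  set y : ℝ := i / (2 * M + 1) with hy
  have hyi : y * (2 * M + 1) = i := by rw [hy]; field_simp
  have hi' : (i : ℝ) ≤ M := by exact_mod_cast hi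
  have hy0 : 0 ≤ y := by positivity
  have hy1 : y ≤ 1 / 2 := by
    rw [hy, div_le_iff₀ hN]; linarith
  have h4 : y * boxSum M h (M + 1) ≤ ∑ j ∈ range i, h (1 + j) := by
    refine le_of_mul_le_mul_left ?_ hM'
    calc (M : ℝ) * (y * boxSum M h (M + 1)) = y * (M * boxSum M h (M + 1)) := by ring
      _ ≤ y * ((2 * M + 1) * ∑ j ∈ range M, h (1 + j)) := mul_le_mul_of_nonneg_left h3 hy0
      _ = i * ∑ j ∈ range M, h (1 + j) := by rw [← mul_assoc, hyi]
      _ ≤ _ := h2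
  have h5 : boxSum M h (M + 1 + i) ≤ boxSum M h (M + 1) * (1 - 31 / 100 * y) := by linarith
  refine (pow_le_pow_left₀ (boxSum_nonneg H _) h5 2).trans ?_
  rw [mul_pow]
  refine mul_le_mul_of_nonneg_left ?_ (sq_nonneg _)
  nlinarith

lemma sum_boxSum_sq_le (H : IsBump h) (hM : 1 ≤ M) (hw : h (2 * M + 2) ≤ 69 / 100 * h 1)
    (hr : boxSum M h (M + 1) ^ 2 ≤ 9 / 10 * boxSum M h 0 ^ 2) :
    ∑ i ∈ range (M + 1), boxSum M h (M + 1 + i) ^ 2 ≤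
      89 / 100 * ∑ i ∈ range (M + 1), boxSum M h i ^ 2 := by
  set s := boxSum M h (M + 1) ^ 2 with hs
  have hM' : (1 : ℝ) ≤ M := by exact_mod_cast hM
  have hs0 : 0 ≤ s := sq_nonneg _
  have h1 : ∑ i ∈ range (M + 1), boxSum M h (M + 1 + i) ^ 2 ≤
      ∑ i ∈ range (M + 1), s * (1 - 571 / 1000 * ((i : ℝ) / (2 * M + 1))) :=
    sum_le_sum fun i hi => boxSum_sq_drop H hM hw (by have := mem_range.1 hi; omega)
  have h2 : ∑ i ∈ range (M + 1), (i : ℝ) = M * (M + 1) / 2 := by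
    have h' := congrArg (Nat.cast : ℕ → ℝ) (sum_range_id_mul_two (M + 1))
    rw [Nat.add_sub_cancel] at h'
    push_cast at h'
    linarith
  rw [← mul_sum, sum_sub_distrib, ← mul_sum, ← sum_div, h2] at h1
  simp only [sum_const, card_range, nsmul_eq_mul, mul_one] at h1
  push_cast at h1
  have h3 : M * s ≤ ∑ i ∈ range M, boxSum M h (i + 1 : ℕ) ^ 2 := by
    simpa using card_nsmul_le_sum (range M) (fun i : ℕ => boxSum M h (i + 1 : ℕ) ^ 2) s
      fun i hi => pow_le_pow_left₀ (boxSum_nonneg H _) (boxSum_anti H _ _ (by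
        have := mem_range.1 hi
        rw [abs_of_nonneg, abs_of_nonneg] <;> omega)) 2
  rw [sum_range_succ' (fun i : ℕ => boxSum M h i ^ 2)]
  simp only [Nat.cast_zero]
  have h4 : (M : ℝ) + 1 - 571 / 1000 * (M * (M + 1) / 2 / (2 * M + 1)) ≤
      89 / 100 * (M + 10 / 9) := by
    have : (M : ℝ) * (M + 1) / 2 / (2 * M + 1) * (2 * M + 1) = M * (M + 1) / 2 := by
      field_simp
    have hN : (0 : ℝ) < 2 * M + 1 := by positivity
    refine le_of_mul_le_mul_right ?_ hN
    nlinarith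
  have h5 := mul_le_mul_of_nonneg_left h4 hs0
  linarith

end BoxSum

open Finset in
/-- The number of grounded functions with prescribed root value, defined by recursion on the
depth. -/
def rootCount (d M : ℕ) : ℕ → ℤ → ℝ
  | 0, t => if t = 0 then 1 else 0
  | k + 1, t => boxSum M (rootCount d M k) t ^ d

lemma isBump_rootCount (d M k : ℕ) : IsBump (rootCount d M k) := by
  induction k with
  | zero =>
    refine ⟨fun x => ?_, by simp [rootCount], fun x y hxy => ?_, fun a b hab => ?_⟩
    · simp only [rootCount]; split_ifs <;> norm_num
    · simp only [rootCount]
      split_ifs with h1 h2 <;> norm_num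
      subst h1; simp at hxy; exact h2 hxy
    · simp only [rootCount]
      split_ifs <;> first | omega | norm_num
  | succ k ih => exact isBump_boxSum_pow ih d

lemma rootCount_zero_of_pos (d M : ℕ) {t : ℤ} (ht : 0 < t) : rootCount d M 0 t = 0 := by
  simp [rootCount, ht.ne']

lemma rootCount_succ_le_of_three_le {d M : ℕ} (hd : 3 ≤ d) (k : ℕ) :
    rootCount d M k (M + 1) ≤ (3 / 4) ^ d * rootCount d M k 0 := by
  induction k with
  | zero =>
    rw [rootCount_zero_of_pos _ _ (by omega)]
    exact mul_nonneg (by positivity) (isBump_rootCount _ _ _).pos.le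
  | succ k ih =>
    have H := isBump_rootCount d M k
    have hα : (3 / 4 : ℝ) ^ d ≤ 1 / 2 :=
      (pow_le_pow_of_le_one (by norm_num) (by norm_num) hd).trans (by norm_num)
    have h1 := boxSum_succ_le H (by linarith) (sum_window_le H (by positivity) ih)
    simp only [rootCount]
    rw [← mul_pow]
    refine pow_le_pow_left₀ (boxSum_nonneg H _) (h1.trans ?_) d
    exact mul_le_mul_of_nonneg_right (by linarith) (boxSum_nonneg H _)

open Finset in
lemma rootCount_two_bounds {M : ℕ} (hM : 1 ≤ M) (k : ℕ) :
    rootCount 2 M k (M + 1) ≤ 9 / 10 * rootCount 2 M k 0 ∧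
    rootCount 2 M k (2 * M + 2) ≤ 69 / 100 * rootCount 2 M k 1 ∧
    ∑ i ∈ range (M + 1), rootCount 2 M k (M + 1 + i) ≤
      89 / 100 * ∑ i ∈ range (M + 1), rootCount 2 M k i := by
  induction k with
  | zero =>
    have H := isBump_rootCount 2 M 0
    refine ⟨?_, ?_, ?_⟩
    · rw [rootCount_zero_of_pos _ _ (by omega)]
      exact mul_nonneg (by norm_num) (H.nonneg _)
    · rw [rootCount_zero_of_pos _ _ (by omega)]
      exact mul_nonneg (by norm_num) (H.nonneg _)
    · rw [sum_eq_zero fun i _ => rootCount_zero_of_pos _ _ (by omega)]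
      exact mul_nonneg (by norm_num) (sum_nonneg fun i _ => H.nonneg _)
  | succ k ih =>
    obtain ⟨hr, hw, hb⟩ := ih
    have H := isBump_rootCount 2 M k
    have h1 := pow_le_pow_left₀ (boxSum_nonneg H _) (boxSum_succ_le H (by norm_num) hb) 2
    have h2 := pow_le_pow_left₀ (boxSum_nonneg H _) (boxSum_two_mul_add_two_le H hM hr hw) 2
    rw [mul_pow] at h1 h2
    have hr' : boxSum M (rootCount 2 M k) (M + 1) ^ 2 ≤
        9 / 10 * boxSum M (rootCount 2 M k) 0 ^ 2 :=
      h1.trans (mul_le_mul_of_nonneg_right (by norm_num) (sq_nonneg _))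
    exact ⟨hr', h2.trans (mul_le_mul_of_nonneg_right (by norm_num) (sq_nonneg _)),
      sum_boxSum_sq_le H hM hw hr'⟩

lemma rootCount_tail {d M : ℕ} (hM : 1 ≤ M) {α : ℝ} (hα : 0 ≤ α)
    (h1 : ∀ k, rootCount d M k (M + 1) ≤ α * rootCount d M k 0) (k : ℕ) (t : ℤ) (ht : 1 ≤ t) :
    rootCount d M k (M + t) ≤ α ^ (d ^ ((t - 1) / (M : ℤ)).toNat) * rootCount d M k 0 := by
  induction k generalizing t with
  | zero =>
    rw [rootCount_zero_of_pos _ _ (by omega)]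
    exact mul_nonneg (by positivity) (isBump_rootCount _ _ _).pos.le
  | succ k ih =>
    rcases le_or_gt t M with htM | htM
    · rw [Int.ediv_eq_zero_of_lt (by omega) (by omega)]
      simp only [Int.toNat_zero, pow_zero, pow_one]
      exact ((isBump_rootCount d M (k + 1)).anti_of_nonneg (by omega) (by omega)).trans (h1 _)
    · have H := isBump_rootCount d M k
      have e : (t - 1) / (M : ℤ) = (t - M - 1) / M + 1 := by
        rw [← Int.add_mul_ediv_right _ 1 (by omega : (M : ℤ) ≠ 0)]
        congr 1; ring
      have e' : ((t - 1) / (M : ℤ)).toNat = ((t - M - 1) / (M : ℤ)).toNat + 1 := by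
        have : 0 ≤ (t - M - 1) / (M : ℤ) := Int.ediv_nonneg (by omega) (by omega)
        omega
      have h2 := ih (t - M) (by omega)
      rw [add_sub_cancel] at h2
      have h3 := boxSum_shift_le (M := M) H (t := t) (by omega) (by positivity) h2
      rw [e', pow_succ, pow_mul]
      simp only [rootCount]
      rw [← mul_pow]
      exact pow_le_pow_left₀ (boxSum_nonneg H _) h3 d

section Counting

/-- Restricting to the subtrees of the children of the root. -/
def subtreeEquiv (d k M : ℕ) (t : ℤ) :
    {f : Vtx d (k + 1) → ℤ // f ∈ LM d (k + 1) M ∧ f (rootV d (k + 1)) = t} ≃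
      (Fin d → {f : Vtx d k → ℤ // f ∈ LM d k M ∧ |f (rootV d k) - t| ≤ (M : ℤ)}) where
  toFun f j := ⟨fun v => f.1 ⟨j :: v.1, by simpa using v.2⟩, by
    obtain ⟨f, ⟨h0, hL⟩, ht⟩ := f
    refine ⟨⟨fun v hv => h0 _ (by simpa using hv), fun l hl i => ?_⟩, ?_⟩
    · exact hL (j :: l) (by simpa using hl) i
    · have := hL [] (by simp) j
      subst ht
      exact this⟩
  invFun φ := ⟨fun v => match v with
      | ⟨[], _⟩ => t
      | ⟨j :: l, h⟩ => (φ j).1 ⟨l, by simpa using h⟩, by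
    refine ⟨⟨?_, ?_⟩, rfl⟩
    · rintro ⟨_ | ⟨j, l⟩, h⟩ hv
      · simp at hv
      · exact (φ j).2.1.1 ⟨l, by simpa using h⟩ (by simpa using hv)
    · rintro (_ | ⟨j, l⟩) hl i
      · exact (φ i).2.2
      · exact (φ j).2.1.2 l (by simpa using hl) i⟩
  left_inv := by
    rintro ⟨f, hf, ht⟩
    ext ⟨_ | ⟨j, l⟩, h⟩
    · exact ht.symm
    · rfl
  right_inv φ := rfl

/-- The functions whose root value is close to `t`, classified by their root value. -/
def rootFiberEquiv (d k M : ℕ) (t : ℤ) :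
    {f : Vtx d k → ℤ // f ∈ LM d k M ∧ |f (rootV d k) - t| ≤ (M : ℤ)} ≃
      Σ i : Fin (2 * M + 1),
        {f : Vtx d k → ℤ // f ∈ LM d k M ∧ f (rootV d k) = t - M + (i : ℕ)} where
  toFun f := ⟨⟨(f.1 (rootV d k) - t + M).toNat, by have := abs_le.1 f.2.2; omega⟩,
    f.1, f.2.1, by have := abs_le.1 f.2.2; simp only; omega⟩
  invFun x := ⟨x.2.1, x.2.2.1, by
    have h1 := x.2.2.2
    have h2 := x.1.2
    rw [abs_le]; omega⟩
  left_inv f := rfl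
  right_inv := by
    rintro ⟨⟨i, hi⟩, f, hf, ht⟩
    have : (f (rootV d k) - t + M).toNat = i := by simp only at ht; omega
    subst this
    rfl

lemma finite_rootFiber (d k M : ℕ) (t : ℤ) :
    Finite {f : Vtx d k → ℤ // f ∈ LM d k M ∧ f (rootV d k) = t} := by
  induction k generalizing t with
  | zero =>
    have : Subsingleton {f : Vtx d 0 → ℤ // f ∈ LM d 0 M ∧ f (rootV d 0) = t} := by
      refine ⟨fun f g => Subtype.ext (funext fun v => ?_)⟩
      rw [f.2.1.1 v (Nat.le_zero.1 v.2), g.2.1.1 v (Nat.le_zero.1 v.2)]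
    infer_instance
  | succ k ih =>
    have : Finite {f : Vtx d k → ℤ // f ∈ LM d k M ∧ |f (rootV d k) - t| ≤ (M : ℤ)} :=
      Finite.of_equiv _ (rootFiberEquiv d k M t).symm
    exact Finite.of_equiv _ (subtreeEquiv d k M t).symm

open Finset in
lemma G_succ (d k M : ℕ) (t : ℤ) :
    G d (k + 1) M t = (∑ i ∈ range (2 * M + 1), G d k M (t - M + i)) ^ d := by
  have := finite_rootFiber d k M
  rw [G, Nat.card_congr (subtreeEquiv d k M t), Nat.card_fun, Nat.card_fin,
    Nat.card_congr (rootFiberEquiv d k M t), Nat.card_sigma, Finset.sum_range]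
  rfl

lemma G_zero (d M : ℕ) (t : ℤ) : G d 0 M t = if t = 0 then 1 else 0 := by
  unfold G
  split_ifs with h
  · subst h
    rw [Nat.card_eq_one_iff_unique]
    refine ⟨⟨fun f g => Subtype.ext (funext fun v => ?_)⟩,
      ⟨⟨fun _ => 0, ⟨fun _ _ => rfl, fun l hl => by omega⟩, rfl⟩⟩⟩
    rw [f.2.1.1 v (Nat.le_zero.1 v.2), g.2.1.1 v (Nat.le_zero.1 v.2)]
  · have : IsEmpty {f : Vtx d 0 → ℤ // f ∈ LM d 0 M ∧ f (rootV d 0) = t} :=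
      ⟨fun f => h (f.2.2.symm.trans (f.2.1.1 _ rfl))⟩
    exact Nat.card_of_isEmpty

lemma G_eq_rootCount (d k M : ℕ) (t : ℤ) : (G d k M t : ℝ) = rootCount d M k t := by
  induction k generalizing t with
  | zero => rw [G_zero, rootCount]; split_ifs <;> simp
  | succ k ih =>
    rw [G_succ, rootCount, boxSum]
    push_cast
    simp only [ih]

end Counting

/-- **Lower tail (by symmetry).**  Let `α = 9/10` if `d = 2` and `α = (3/4)^d`
if `d ≥ 3`.  If `f` is chosen uniformly at random from `L_M(d,k)`, then for
every integer `t ≥ 1`,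
`Pr(f(v₀) = -(M + t)) ≤ α^(d^⌊(t-1)/M⌋) * Pr(f(v₀) = 0)`. -/
theorem lipschitz_tree_root_lower_tail (d M k : ℕ) (hd : 2 ≤ d) (hM : 1 ≤ M)
    (hk : 1 ≤ k) (t : ℤ) (ht : 1 ≤ t) (α : ℝ)
    (hα : α = if d = 2 then (9 / 10 : ℝ) else (3 / 4 : ℝ) ^ d) :
    PrRoot d k M (-((M : ℤ) + t)) ≤
      α ^ (d ^ ((t - 1) / (M : ℤ)).toNat) * PrRoot d k M 0 := by
  have hα0 : 0 ≤ α := by rw [hα]; split_ifs <;> positivity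
  have h1 : ∀ k, rootCount d M k (M + 1) ≤ α * rootCount d M k 0 := by
    intro k
    rw [hα]
    split_ifs with h
    · subst h
      exact (rootCount_two_bounds hM k).1
    · exact rootCount_succ_le_of_three_le (by omega) k
  have h2 := rootCount_tail hM hα0 h1 k t ht
  unfold PrRoot
  rw [G_eq_rootCount, G_eq_rootCount, (isBump_rootCount d M k).symm, ← mul_div_assoc]
  exact div_le_div_of_nonneg_right h2 (Nat.cast_nonneg _)
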